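/- Suppose there exists ε ∈ (0,1] such that for every subset Λ ⊆ [n] with |Λ| ≤ n−2, every partial assignment x_Λ with π_Λ(x_Λ) > 0, every pair of distinct indices i, j ∈ [n]∖Λ, and every pair of values x_i, x'_i ∈ 𝒳_i with π_i^{x_Λ}(x_i) > 0 and π_i^{x_Λ}(x'_i) > 0, one has d_TV(π_j^{x_Λ, x_i}, π_j^{x_Λ, x'_i}) ≤ 1 − ε. Then for every function f : 𝒳 → ℝ≥0, Ent f ≤ ((2 + log(1/π_min))/ε^{n−1}) · Σ_{i=1}^n E[Ent_i f]. -/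

import Mathlib

open scoped BigOperators Classical

noncomputable section

/-- Expectation of `f` under the (finitely supported) density `p`. -/
def pmean {α : Type*} [Fintype α] (p f : α → ℝ) : ℝ := ∑ a, p a * f a

/-- Variance of `f` under the density `p`. -/
def pvar {α : Type*} [Fintype α] (p f : α → ℝ) : ℝ :=
  pmean p (fun a => (f a - pmean p f) ^ 2)

/-- Entropy of `f` under the density `p` (with the convention `0 log 0 = 0`,
which is automatic since `Real.log 0 = 0`). -/
def pent {α : Type*} [Fintype α] (p f : α → ℝ) : ℝ :=
  pmean p (fun a => f a * Real.log (f a)) - pmean p f * Real.log (pmean p f)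

/-- Total variation distance between two densities. -/
def ptv {α : Type*} [Fintype α] (p q : α → ℝ) : ℝ := (1 / 2) * ∑ a, |p a - q a|

variable {n : ℕ} {𝒳 : Fin n → Type*} [∀ i, Fintype (𝒳 i)] [∀ i, Nonempty (𝒳 i)]

/-- Probability of the event `E` under the density `π`. -/
def prEvent (π : (∀ i, 𝒳 i) → ℝ) (E : (∀ i, 𝒳 i) → Prop) : ℝ :=
  ∑ σ ∈ Finset.univ.filter E, π σ

/-- The conditional marginal distribution of coordinate `j` given agreement with `τ`
on the coordinates in `Λ`. -/
def cmarg (π : (∀ i, 𝒳 i) → ℝ) (Λ : Finset (Fin n)) (τ : ∀ i, 𝒳 i) (j : Fin n) :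
    𝒳 j → ℝ :=
  fun c => prEvent π (fun σ => (∀ k ∈ Λ, σ k = τ k) ∧ σ j = c) /
    prEvent π (fun σ => ∀ k ∈ Λ, σ k = τ k)

/-- The conditional density of `π` given that the configuration agrees with `σ`
outside the (free) set `B`. -/
def condD (π : (∀ i, 𝒳 i) → ℝ) (B : Finset (Fin n)) (σ : ∀ i, 𝒳 i) :
    (∀ i, 𝒳 i) → ℝ :=
  fun τ => if ∀ k, k ∉ B → τ k = σ k
    then π τ / prEvent π (fun τ' => ∀ k, k ∉ B → τ' k = σ k)
    else 0

section ConditionalMean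

variable {Ω α β : Type*} [Fintype Ω]

/-- Conditional expectation of `f` given the value of `X`, under the weight `μ`. -/
def condMean (μ : Ω → ℝ) (X : Ω → α) (f : Ω → ℝ) (σ : Ω) : ℝ :=
  (∑ σ' with X σ' = X σ, μ σ' * f σ') / ∑ σ' with X σ' = X σ, μ σ'

/-- Conditional law of `Y` given that `X` takes the value `X σ`, under the weight `μ`. -/
def condLaw (μ : Ω → ℝ) (X : Ω → α) (Y : Ω → β) (σ : Ω) (y : β) : ℝ :=
  (∑ σ' with X σ' = X σ ∧ Y σ' = y, μ σ') / ∑ σ' with X σ' = X σ, μ σ'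

/-- Total mass times the variance of `f` under the weight `μ`. -/
def wvar (μ f : Ω → ℝ) : ℝ := ∑ σ, μ σ * f σ ^ 2 - (∑ σ, μ σ * f σ) ^ 2 / ∑ σ, μ σ

theorem condMean_factorsThrough (μ : Ω → ℝ) (X : Ω → α) (f : Ω → ℝ) :
    (condMean μ X f).FactorsThrough X := by
  intro a b h
  simp only [condMean, h]

theorem sum_condMean_mul {μ : Ω → ℝ} (hμ : ∀ σ, 0 ≤ μ σ) (X : Ω → α) (f : Ω → ℝ) {h : Ω → ℝ}
    (hh : h.FactorsThrough X) :
    ∑ σ, μ σ * (condMean μ X f σ * h σ) = ∑ σ, μ σ * (f σ * h σ) := by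
  have h1 : ∀ σ, μ σ * (condMean μ X f σ * h σ) =
      ∑ σ', if X σ' = X σ then (μ σ * h σ' * (μ σ' * f σ')) / ∑ t with X t = X σ', μ t else 0 := by
    intro σ
    rw [condMean, ← Finset.sum_filter, div_mul_eq_mul_div, mul_div_assoc', Finset.sum_mul,
      Finset.mul_sum, Finset.sum_div]
    refine Finset.sum_congr rfl fun σ' hσ' => ?_
    have e : X σ' = X σ := (Finset.mem_filter.mp hσ').2
    rw [e, hh e]
    ring
  simp_rw [h1]
  rw [Finset.sum_comm]
  refine Finset.sum_congr rfl fun σ' _ => ?_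
  rcases (hμ σ').eq_or_lt with h0 | h0
  · simp [← h0]
  have hZ : 0 < ∑ t with X t = X σ', μ t :=
    lt_of_lt_of_le h0 (Finset.single_le_sum (f := μ) (fun i _ => hμ i) (by simp))
  rw [← Finset.sum_filter, ← Finset.sum_div, ← Finset.sum_mul, ← Finset.sum_mul]
  simp only [eq_comm (a := X σ')]
  field_simp

theorem sum_condMean {μ : Ω → ℝ} (hμ : ∀ σ, 0 ≤ μ σ) (X : Ω → α) (f : Ω → ℝ) :
    ∑ σ, μ σ * condMean μ X f σ = ∑ σ, μ σ * f σ := by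
  simpa using sum_condMean_mul hμ X f (h := fun _ => 1) (fun _ _ _ => rfl)

theorem sq_sum_mul_le {μ : Ω → ℝ} (hμ : ∀ σ, 0 ≤ μ σ) (f g : Ω → ℝ) :
    (∑ σ, μ σ * (f σ * g σ)) ^ 2 ≤ (∑ σ, μ σ * f σ ^ 2) * ∑ σ, μ σ * g σ ^ 2 := by
  refine Finset.sum_sq_le_sum_mul_sum_of_sq_le_mul _ (fun i _ => mul_nonneg (hμ i) (sq_nonneg _))
    (fun i _ => mul_nonneg (hμ i) (sq_nonneg _)) (fun i _ => (by ring : _ = _).le)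

theorem sum_mul_sq_nonneg {μ : Ω → ℝ} (hμ : ∀ σ, 0 ≤ μ σ) (f : Ω → ℝ) :
    0 ≤ ∑ σ, μ σ * f σ ^ 2 :=
  Finset.sum_nonneg fun i _ => mul_nonneg (hμ i) (sq_nonneg _)

theorem abs_condMean_sub_le [Fintype β] {μ : Ω → ℝ} (hμ : ∀ σ, 0 ≤ μ σ) (X : Ω → α) (Y : Ω → β)
    {δ : ℝ}
    (hTV : ∀ σ σ', 0 < μ σ → 0 < μ σ' →
      ∑ y, |condLaw μ X Y σ y - condLaw μ X Y σ' y| ≤ 2 * δ)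
    {w : Ω → ℝ} (hw : w.FactorsThrough Y) {R : ℝ}
    (hR : ∀ σ σ', 0 < μ σ → 0 < μ σ' → |w σ - w σ'| ≤ R) {σ σ' : Ω} (h : 0 < μ σ)
    (h' : 0 < μ σ') : |condMean μ X w σ - condMean μ X w σ'| ≤ δ * R := by
  have hne : (Finset.univ.filter fun t => 0 < μ t).Nonempty := ⟨σ, by simpa using h⟩
  obtain ⟨a, ha, hmax⟩ := Finset.exists_max_image _ w hne
  obtain ⟨b, hb, hmin⟩ := Finset.exists_min_image _ w hne
  simp only [Finset.mem_filter, Finset.mem_univ, true_and] at ha hb hmax hmin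
  set c := (w a + w b) / 2 with hc
  have hab := le_of_abs_le (hR a b ha hb)
  have hwc : ∀ t, 0 < μ t → |w t - c| ≤ R / 2 := fun t ht => by
    have := hmax t ht
    have := hmin t ht
    rw [abs_le]
    constructor <;> linarith
  have hR0 : 0 ≤ R := (abs_nonneg _).trans (hR a b ha hb)
  have hcm : ∀ s, 0 < μ s → condMean μ X w s - c =
      ∑ y, ∑ t with Y t = y, (if X t = X s then μ t else 0) /
        (∑ t with X t = X s, μ t) * (w t - c) := by
    intro s hs
    have hZ : 0 < ∑ t with X t = X s, μ t :=
      lt_of_lt_of_le hs (Finset.single_le_sum (f := μ) (fun i _ => hμ i) (by simp))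
    rw [Finset.sum_fiberwise Finset.univ Y, condMean, sub_eq_iff_eq_add, div_eq_iff hZ.ne', add_mul,
      Finset.sum_mul]
    conv_rhs =>
      enter [2]
      rw [Finset.mul_sum, Finset.sum_filter]
    generalize ∑ t with X t = X s, μ t = Z at hZ
    rw [Finset.sum_filter, ← Finset.sum_add_distrib]
    refine Finset.sum_congr rfl fun t _ => ?_
    split_ifs
    · field_simp
      ring
    · simp
  have hlaw : ∀ s y, condLaw μ X Y s y = ∑ t with Y t = y, (if X t = X s then μ t else 0) /
        (∑ t with X t = X s, μ t) := by
    intro s y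
    rw [condLaw, ← Finset.sum_div, ← Finset.sum_filter, Finset.filter_filter]
    simp only [and_comm]
  have key : ∀ y, |∑ t with Y t = y, (if X t = X σ then μ t else 0) /
        (∑ t with X t = X σ, μ t) * (w t - c) - ∑ t with Y t = y, (if X t = X σ' then μ t else 0) /
        (∑ t with X t = X σ', μ t) * (w t - c)| ≤
      |condLaw μ X Y σ y - condLaw μ X Y σ' y| * (R / 2) := by
    intro y
    by_cases hy : ∃ s, Y s = y ∧ 0 < μ s
    · obtain ⟨s, rfl, hs⟩ := hy
      have e : ∀ u, ∑ t with Y t = Y s, (if X t = X u then μ t else 0) /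
          (∑ t with X t = X u, μ t) * (w t - c) = condLaw μ X Y u (Y s) * (w s - c) := by
        intro u
        rw [hlaw, Finset.sum_mul]
        refine Finset.sum_congr rfl fun t ht => ?_
        rw [hw (Finset.mem_filter.mp ht).2]
      rw [e, e, ← sub_mul, abs_mul]
      exact mul_le_mul_of_nonneg_left (hwc s hs) (abs_nonneg _)
    · push Not at hy
      have e : ∀ u, ∑ t with Y t = y, (if X t = X u then μ t else 0) /
          (∑ t with X t = X u, μ t) * (w t - c) = 0 := by
        intro u
        refine Finset.sum_eq_zero fun t ht => ?_
        have : μ t = 0 := le_antisymm (hy t (Finset.mem_filter.mp ht).2) (hμ t)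
        simp [this]
      rw [e, e, sub_zero, abs_zero]
      positivity
  calc |condMean μ X w σ - condMean μ X w σ'|
      = |(condMean μ X w σ - c) - (condMean μ X w σ' - c)| := by ring_nf
    _ ≤ ∑ y, |condLaw μ X Y σ y - condLaw μ X Y σ' y| * (R / 2) := by
        rw [hcm σ h, hcm σ' h', ← Finset.sum_sub_distrib]
        exact (Finset.abs_sum_le_sum_abs _ _).trans (Finset.sum_le_sum fun y _ => key y)
    _ ≤ 2 * δ * (R / 2) := by
        rw [← Finset.sum_mul]
        exact mul_le_mul_of_nonneg_right (hTV σ σ' h h') (by positivity)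
    _ = δ * R := by ring

theorem sum_mul_sq_le_of_osc {μ : Ω → ℝ} (hμ : ∀ σ, 0 ≤ μ σ) {w : Ω → ℝ}
    (h0 : ∑ σ, μ σ * w σ = 0) {R : ℝ}
    (hR : ∀ σ σ', 0 < μ σ → 0 < μ σ' → |w σ - w σ'| ≤ R) :
    ∑ σ, μ σ * w σ ^ 2 ≤ (∑ σ, μ σ) * R ^ 2 := by
  rw [Finset.sum_mul]
  refine Finset.sum_le_sum fun σ _ => ?_
  rcases (hμ σ).eq_or_lt with h | h
  · simp [← h]
  have hZ : 0 < ∑ t, μ t :=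
    lt_of_lt_of_le h (Finset.single_le_sum (f := μ) (fun i _ => hμ i) (by simp))
  have hR0 : 0 ≤ R := (abs_nonneg _).trans (hR σ σ h h)
  refine mul_le_mul_of_nonneg_left ?_ h.le
  refine sq_le_sq' ?_ ?_
  all_goals
    refine le_of_mul_le_mul_left ?_ hZ
    have e : (∑ t, μ t) * w σ = ∑ t, μ t * (w σ - w t) := by
      simp only [mul_sub, Finset.sum_sub_distrib, h0, sub_zero, Finset.sum_mul]
    rw [e, Finset.sum_mul]
    refine Finset.sum_le_sum fun t _ => ?_
    rcases (hμ t).eq_or_lt with ht | ht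
    · simp [← ht]
    · have := abs_le.mp (hR σ t h ht)
      exact mul_le_mul_of_nonneg_left (by linarith) ht.le

/-- A log-convex sequence growing at most like `q ^ k` has first ratio at most `q`. -/
theorem le_mul_of_logConvex_of_le_geometric {b : ℕ → ℝ} (hb : ∀ k, 0 ≤ b k)
    (hconv : ∀ k, b (k + 1) ^ 2 ≤ b k * b (k + 2)) {C q : ℝ} (hq : 0 ≤ q)
    (hC : ∀ k, b k ≤ C * q ^ k) : b 1 ≤ q * b 0 := by
  by_contra! hlt
  have hb1 : 0 < b 1 := (mul_nonneg hq (hb 0)).trans_lt hlt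
  have hb0 : 0 < b 0 := by
    rcases (hb 0).eq_or_lt with h | h
    · have := hconv 0
      rw [← h] at this
      simp only [zero_add, zero_mul] at this
      nlinarith
    · exact h
  set t := b 1 / b 0 with ht
  have ht0 : 0 < t := div_pos hb1 hb0
  have hqt : q < t := by rwa [ht, lt_div_iff₀ hb0]
  have hstep : ∀ k, 0 < b k ∧ t * b k ≤ b (k + 1) := by
    intro k
    induction k with
    | zero => exact ⟨hb0, by rw [ht]; field_simp; exact le_rfl⟩
    | succ k ih =>
      obtain ⟨h1, h2⟩ := ih
      have h3 : 0 < b (k + 1) := (mul_pos ht0 h1).trans_le h2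
      refine ⟨h3, ?_⟩
      refine le_of_mul_le_mul_left ?_ h1
      have := hconv k
      nlinarith
  have hpow : ∀ k, b 0 * t ^ k ≤ b k := by
    intro k
    induction k with
    | zero => simp
    | succ k ih =>
      have := (hstep k).2
      rw [pow_succ]
      nlinarith
  have hlim := tendsto_pow_atTop_nhds_zero_of_lt_one (div_nonneg hq ht0.le)
    ((div_lt_one ht0).2 hqt)
  have hlim2 := hlim.const_mul C
  rw [mul_zero] at hlim2
  obtain ⟨k, hk⟩ := (hlim2.eventually (gt_mem_nhds hb0)).exists
  have h4 := (hpow k).trans (hC k)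
  have htk : 0 < t ^ k := pow_pos ht0 k
  rw [div_pow, mul_div_assoc', div_lt_iff₀ htk] at hk
  linarith

/-- Maximal correlation is bounded by the two total-variation contraction coefficients. -/
theorem sum_condMean_sq_le [Fintype α] [Fintype β] {μ : Ω → ℝ} (hμ : ∀ σ, 0 ≤ μ σ) (X : Ω → α)
    (Y : Ω → β) {δ : ℝ}
    (hXY : ∀ σ σ', 0 < μ σ → 0 < μ σ' →
      ∑ y, |condLaw μ X Y σ y - condLaw μ X Y σ' y| ≤ 2 * δ)
    (hYX : ∀ σ σ', 0 < μ σ → 0 < μ σ' →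
      ∑ x, |condLaw μ Y X σ x - condLaw μ Y X σ' x| ≤ 2 * δ)
    {w : Ω → ℝ} (hw : w.FactorsThrough Y) (h0 : ∑ σ, μ σ * w σ = 0) :
    ∑ σ, μ σ * condMean μ X w σ ^ 2 ≤ δ ^ 2 * ∑ σ, μ σ * w σ ^ 2 := by
  let K : (Ω → ℝ) → Ω → ℝ := fun u => condMean μ Y (condMean μ X u)
  let u : ℕ → Ω → ℝ := fun k => K^[k] w
  have hu : ∀ k, u (k + 1) = condMean μ Y (condMean μ X (u k)) := fun k =>
    Function.iterate_succ_apply' K k w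
  have hmeas : ∀ k, (u k).FactorsThrough Y := by
    intro k
    cases k with
    | zero => exact hw
    | succ k => rw [hu]; exact condMean_factorsThrough _ _ _
  have hmean : ∀ k, ∑ σ, μ σ * u k σ = 0 := by
    intro k
    induction k with
    | zero => exact h0
    | succ k ih => rw [hu, sum_condMean hμ, sum_condMean hμ, ih]
  have hsymm : ∀ k l, ∑ σ, μ σ * (u (k + 1) σ * u l σ) =
      ∑ σ, μ σ * (condMean μ X (u k) σ * condMean μ X (u l) σ) := by
    intro k l
    rw [hu, sum_condMean_mul hμ Y _ (hmeas l)]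
    have := sum_condMean_mul hμ X (u l) (condMean_factorsThrough μ X (u k))
    simp only [mul_comm (condMean μ X (u k) _)] at *
    exact this.symm
  have hsymm' : ∀ k l, ∑ σ, μ σ * (u (k + 1) σ * u l σ) = ∑ σ, μ σ * (u k σ * u (l + 1) σ) := by
    intro k l
    have := hsymm l k
    simp only [mul_comm (u k _)]
    rw [hsymm, hsymm]
    simp only [mul_comm]
  obtain ⟨R, hR⟩ : ∃ R, ∀ σ σ', 0 < μ σ → 0 < μ σ' → |w σ - w σ'| ≤ R :=
    ⟨∑ s, ∑ t, |w s - w t|, fun σ σ' _ _ =>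
      (Finset.single_le_sum (f := fun t => |w σ - w t|) (fun _ _ => abs_nonneg _)
        (Finset.mem_univ σ')).trans
      (Finset.single_le_sum (f := fun s => ∑ t, |w s - w t|)
        (fun _ _ => Finset.sum_nonneg fun _ _ => abs_nonneg _) (Finset.mem_univ σ))⟩
  have hosc : ∀ k, ∀ σ σ', 0 < μ σ → 0 < μ σ' → |u k σ - u k σ'| ≤ (δ * δ) ^ k * R := by
    intro k
    induction k with
    | zero =>
      intro σ σ' h h'
      rw [pow_zero, one_mul]
      exact hR σ σ' h h'
    | succ k ih =>
      intro σ σ' h h'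
      rw [hu]
      have := abs_condMean_sub_le hμ Y X hYX (condMean_factorsThrough μ X (u k))
        (fun s s' hs hs' => abs_condMean_sub_le hμ X Y hXY (hmeas k) ih hs hs') h h'
      refine this.trans (le_of_eq ?_)
      ring
  set b : ℕ → ℝ := fun k => ∑ σ, μ σ * u k σ ^ 2 with hbdef
  have hb : ∀ k, 0 ≤ b k := fun k => sum_mul_sq_nonneg hμ _
  have hb1 : b 1 ≤ δ ^ 4 * b 0 := by
    refine le_mul_of_logConvex_of_le_geometric (C := (∑ σ, μ σ) * R ^ 2) hb ?_ (by positivity) ?_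
    · intro k
      have : b (k + 1) = ∑ σ, μ σ * (u k σ * u (k + 2) σ) := by
        rw [← hsymm']
        simp only [hbdef, sq]
      rw [this]
      exact sq_sum_mul_le hμ _ _
    · intro k
      refine (sum_mul_sq_le_of_osc hμ (hmean k) (hosc k)).trans (le_of_eq ?_)
      ring
  have h1 : ∑ σ, μ σ * condMean μ X w σ ^ 2 = ∑ σ, μ σ * (u 1 σ * u 0 σ) := by
    rw [hsymm]
    simp only [sq, u, Function.iterate_zero, id]
  have h2 : (∑ σ, μ σ * condMean μ X w σ ^ 2) ^ 2 ≤ (δ ^ 2 * b 0) ^ 2 := by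
    rw [h1]
    refine (sq_sum_mul_le hμ _ _).trans ?_
    have := mul_le_mul_of_nonneg_right hb1 (hb 0)
    calc b 1 * b 0 ≤ _ := this
      _ = _ := by ring
  exact abs_le_of_sq_le_sq' h2 (mul_nonneg (sq_nonneg _) (hb 0)) |>.2

theorem wvar_sub_const {μ : Ω → ℝ} (hμ : ∀ σ, 0 ≤ μ σ) (f : Ω → ℝ) (a : ℝ) :
    wvar μ (fun σ => f σ - a) = wvar μ f := by
  rcases (Finset.sum_nonneg fun σ (_ : σ ∈ Finset.univ) => hμ σ).eq_or_lt with h | h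
  · have h0 := (Finset.sum_eq_zero_iff_of_nonneg fun σ _ => hμ σ).1 h.symm
    have h1 : ∀ σ, μ σ = 0 := fun σ => h0 σ (Finset.mem_univ σ)
    simp [wvar, h1]
  · have e1 : ∑ σ, μ σ * (f σ - a) ^ 2 =
        ∑ σ, μ σ * f σ ^ 2 - 2 * a * ∑ σ, μ σ * f σ + a ^ 2 * ∑ σ, μ σ := by
      rw [Finset.mul_sum, Finset.mul_sum, ← Finset.sum_sub_distrib, ← Finset.sum_add_distrib]
      exact Finset.sum_congr rfl fun σ _ => by ring
    have e2 : ∑ σ, μ σ * (f σ - a) = ∑ σ, μ σ * f σ - a * ∑ σ, μ σ := by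
      rw [Finset.mul_sum, ← Finset.sum_sub_distrib]
      exact Finset.sum_congr rfl fun σ _ => by ring
    rw [wvar, wvar, e1, e2]
    field_simp
    ring

theorem sum_wvar_fiber [Fintype α] {μ : Ω → ℝ} (X : Ω → α) (f : Ω → ℝ) :
    ∑ c, wvar (fun σ => if X σ = c then μ σ else 0) f =
      ∑ σ, μ σ * f σ ^ 2 - ∑ σ, μ σ * condMean μ X f σ ^ 2 := by
  simp only [wvar, Finset.sum_sub_distrib, ite_mul, zero_mul, ← Finset.sum_filter]
  rw [Finset.sum_fiberwise Finset.univ X]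
  congr 1
  rw [← Finset.sum_fiberwise Finset.univ X]
  refine Finset.sum_congr rfl fun c _ => ?_
  have e : ∀ σ ∈ Finset.univ.filter fun σ => X σ = c, μ σ * condMean μ X f σ ^ 2 =
      μ σ * ((∑ t with X t = c, μ t * f t) / ∑ t with X t = c, μ t) ^ 2 := by
    intro σ hσ
    rw [condMean, (Finset.mem_filter.1 hσ).2]
  rw [Finset.sum_congr rfl e, ← Finset.sum_mul]
  generalize ∑ t with X t = c, μ t = Z
  by_cases hZ : Z = 0
  · simp [hZ]
  · field_simp

/-- If all pairs of coordinates in `B` have total-variation influence at most `δ`, the variances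
of the one-coordinate conditional means sum to at most `1 + (|B| - 1) δ` times the variance. -/
theorem sum_sum_condMean_sq_le {ι : Type*} {α : ι → Type*} [∀ i, Fintype (α i)] {μ : Ω → ℝ}
    (hμ : ∀ σ, 0 ≤ μ σ) (X : ∀ i, Ω → α i) (B : Finset ι) {δ : ℝ} (hδ0 : 0 ≤ δ) (hδ1 : δ ≤ 1)
    (hTV : ∀ i ∈ B, ∀ j ∈ B, i ≠ j → ∀ σ σ', 0 < μ σ → 0 < μ σ' →
      ∑ y, |condLaw μ (X i) (X j) σ y - condLaw μ (X i) (X j) σ' y| ≤ 2 * δ)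
    {g : Ω → ℝ} (hg : ∑ σ, μ σ * g σ = 0) :
    ∑ i ∈ B, ∑ σ, μ σ * condMean μ (X i) g σ ^ 2 ≤
      ((1 - δ) + B.card * δ) * ∑ σ, μ σ * g σ ^ 2 := by
  let G : ι → Ω → ℝ := fun i => condMean μ (X i) g
  let V : ι → ℝ := fun i => ∑ σ, μ σ * G i σ ^ 2
  have hV0 : ∀ i, 0 ≤ V i := fun i => sum_mul_sq_nonneg hμ _
  have hV : ∀ i, V i = ∑ σ, μ σ * (g σ * G i σ) := by
    intro i
    rw [← sum_condMean_mul hμ (X i) g (condMean_factorsThrough μ (X i) g)]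
    exact Finset.sum_congr rfl fun σ _ => by simp only [G, sq]
  have hpair : ∀ i ∈ B, ∀ j ∈ B, ∑ σ, μ σ * (G i σ * G j σ) ≤
      δ / 2 * V i + δ / 2 * V j + if i = j then (1 - δ) * V i else 0 := by
    intro i hi j hj
    split_ifs with hij
    · subst hij
      refine le_of_eq ?_
      simp only [V, sq]
      ring
    · have e : ∑ σ, μ σ * (G i σ * G j σ) = ∑ σ, μ σ * (G i σ * condMean μ (X i) (G j) σ) := by
        have := sum_condMean_mul hμ (X i) (G j) (condMean_factorsThrough μ (X i) g)
        simp only [mul_comm (G i _)]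
        exact this.symm
      have h1 := sq_sum_mul_le hμ (G i) (condMean μ (X i) (G j))
      have h2 := sum_condMean_sq_le hμ (X i) (X j) (hTV i hi j hj hij)
        (hTV j hj i hi (Ne.symm hij)) (condMean_factorsThrough μ (X j) g)
        ((sum_condMean hμ (X j) g).trans hg)
      rw [e, add_zero]
      refine abs_le_of_sq_le_sq (b := δ / 2 * V i + δ / 2 * V j) ?_ ?_ |> le_of_abs_le
      · refine h1.trans ((mul_le_mul_of_nonneg_left h2 (hV0 i)).trans ?_)
        change V i * (δ ^ 2 * V j) ≤ _
        nlinarith [sq_nonneg (δ * (V i - V j))]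
      · have := hV0 i
        have := hV0 j
        positivity
  set W := ∑ i ∈ B, V i with hW
  set Q := ∑ σ, μ σ * g σ ^ 2 with hQ
  have hW0 : 0 ≤ W := Finset.sum_nonneg fun i _ => hV0 i
  have hQ0 : 0 ≤ Q := sum_mul_sq_nonneg hμ g
  have hWS : W = ∑ σ, μ σ * (g σ * ∑ i ∈ B, G i σ) := by
    simp only [hW, hV, Finset.mul_sum]
    rw [Finset.sum_comm]
  have hSS : ∑ σ, μ σ * (∑ i ∈ B, G i σ) ^ 2 ≤ ((1 - δ) + B.card * δ) * W := by
    calc ∑ σ, μ σ * (∑ i ∈ B, G i σ) ^ 2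
        = ∑ i ∈ B, ∑ j ∈ B, ∑ σ, μ σ * (G i σ * G j σ) := by
          simp only [sq, Finset.sum_mul_sum]
          simp only [Finset.mul_sum]
          rw [Finset.sum_comm]
          exact Finset.sum_congr rfl fun i _ => Finset.sum_comm
      _ ≤ ∑ i ∈ B, ∑ j ∈ B, (δ / 2 * V i + δ / 2 * V j + if i = j then (1 - δ) * V i else 0) :=
          Finset.sum_le_sum fun i hi => Finset.sum_le_sum fun j hj => hpair i hi j hj
      _ = ∑ i ∈ B, (B.card * (δ / 2) * V i + δ / 2 * W + (1 - δ) * V i) := by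
          refine Finset.sum_congr rfl fun i hi => ?_
          rw [Finset.sum_add_distrib, Finset.sum_add_distrib, Finset.sum_const,
            ← Finset.mul_sum B V, ← hW, Finset.sum_ite_eq, if_pos hi, nsmul_eq_mul]
          ring
      _ = ((1 - δ) + B.card * δ) * W := by
          rw [Finset.sum_add_distrib, Finset.sum_add_distrib, Finset.sum_const,
            ← Finset.mul_sum B V, ← Finset.mul_sum B V, ← hW, nsmul_eq_mul]
          ring
  have hM0 : 0 ≤ (1 - δ) + B.card * δ := by
    have : 0 ≤ 1 - δ := by linarith
    positivity
  have hsq : W ^ 2 ≤ Q * (((1 - δ) + B.card * δ) * W) := by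
    conv_lhs => rw [hWS]
    exact (sq_sum_mul_le hμ _ _).trans (mul_le_mul_of_nonneg_left hSS hQ0)
  change W ≤ _
  rcases hW0.eq_or_lt with h | h
  · rw [← h]
    positivity
  · refine le_of_mul_le_mul_right ?_ h
    calc W * W = W ^ 2 := by ring
      _ ≤ _ := hsq
      _ = _ := by ring

end ConditionalMean

section Entropy

variable {Ω : Type*} [Fintype Ω]

theorem sum_sub_sq_sum_sqrt_le_pent {p f : Ω → ℝ} (hp : ∀ σ, 0 ≤ p σ) (hf : ∀ σ, 0 ≤ f σ) :
    ∑ σ, p σ * √(f σ) ^ 2 - (∑ σ, p σ * √(f σ)) ^ 2 ≤ pent p f := by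
  simp only [Real.sq_sqrt (hf _)]
  set M := ∑ σ, p σ * f σ with hM
  set m := ∑ σ, p σ * √(f σ) with hm
  have hM0 : 0 ≤ M := Finset.sum_nonneg fun σ _ => mul_nonneg (hp σ) (hf σ)
  have hpt : ∀ σ, p σ * f σ * Real.log M + 2 * (p σ * f σ) - 2 * √M * (p σ * √(f σ)) ≤
      p σ * (f σ * Real.log (f σ)) := by
    intro σ
    rcases (hp σ).eq_or_lt with h0 | h0
    · simp [← h0]
    rcases (hf σ).eq_or_lt with h1 | h1
    · simp [← h1]
    have hMpos : 0 < M := (mul_pos h0 h1).trans_le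
      (Finset.single_le_sum (f := fun σ => p σ * f σ)
        (fun σ _ => mul_nonneg (hp σ) (hf σ)) (Finset.mem_univ σ))
    have hs : 0 < √(f σ) := Real.sqrt_pos.2 h1
    have hS : 0 < √M := Real.sqrt_pos.2 hMpos
    have hlog := Real.log_le_sub_one_of_pos (div_pos hS hs)
    rw [Real.log_div hS.ne' hs.ne', Real.log_sqrt hM0, Real.log_sqrt h1.le] at hlog
    have h2 : f σ * (√M / √(f σ)) = √M * √(f σ) := by
      field_simp
      rw [Real.sq_sqrt h1.le]
    have h3 := mul_le_mul_of_nonneg_left hlog h1.le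
    have h4 : f σ * Real.log M + 2 * f σ - 2 * √M * √(f σ) ≤ f σ * Real.log (f σ) := by
      linarith
    calc _ = p σ * (f σ * Real.log M + 2 * f σ - 2 * √M * √(f σ)) := by ring
      _ ≤ _ := mul_le_mul_of_nonneg_left h4 h0.le
  have hsum := Finset.sum_le_sum fun σ (_ : σ ∈ Finset.univ) => hpt σ
  rw [Finset.sum_sub_distrib, Finset.sum_add_distrib, ← Finset.sum_mul, ← Finset.mul_sum,
    ← Finset.mul_sum, ← hM, ← hm] at hsum
  simp only [pent, pmean]
  rw [← hM]
  nlinarith [sq_nonneg (√M - m), Real.sq_sqrt hM0]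

theorem hasDerivAt_sq_mul_log_sq {a b s : ℝ} (h : a + s * b ≠ 0) :
    HasDerivAt (fun s => (a + s * b) ^ 2 * Real.log ((a + s * b) ^ 2))
      (2 * b * (a + s * b) * (Real.log ((a + s * b) ^ 2) + 1)) s := by
  have h1 : HasDerivAt (fun s => a + s * b) b s := by
    simpa using ((hasDerivAt_id s).mul_const b).const_add a
  have h2 := h1.pow 2
  have h3 := h2.mul (h2.log (pow_ne_zero 2 h))
  refine h3.congr_deriv ?_
  simp only [Pi.pow_apply]
  field_simp
  push_cast
  ring

theorem hasDerivAt_mul_log_sq {a b s : ℝ} (h : a + s * b ≠ 0) :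
    HasDerivAt (fun s => 2 * b * (a + s * b) * (Real.log ((a + s * b) ^ 2) + 1))
      (2 * b ^ 2 * (Real.log ((a + s * b) ^ 2) + 3)) s := by
  have h1 : HasDerivAt (fun s => a + s * b) b s := by
    simpa using ((hasDerivAt_id s).mul_const b).const_add a
  have h2 := h1.pow 2
  have h3 := (h1.const_mul (2 * b)).mul ((h2.log (pow_ne_zero 2 h)).add_const 1)
  refine h3.congr_deriv ?_
  simp only [Pi.pow_apply]
  generalize a + s * b = x at *
  field_simp
  push_cast
  ring

/-- Rothaus' inequality: for `g` centred, the entropy of `(m + g) ^ 2` is at most that of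
`g ^ 2` plus twice the variance. -/
theorem rothaus {p g : Ω → ℝ} (hp : ∀ σ, 0 ≤ p σ) (hsum : ∑ σ, p σ = 1)
    (hg : ∑ σ, p σ * g σ = 0) {m v : ℝ} (hm : 0 < m) (hv : 0 < v)
    (hvar : ∑ σ, p σ * g σ ^ 2 = v) (hpos : ∀ σ, 0 ≤ m + g σ) :
    ∑ σ, p σ * ((m + g σ) ^ 2 * Real.log ((m + g σ) ^ 2)) - (m ^ 2 + v) * Real.log (m ^ 2 + v) ≤
      ∑ σ, p σ * (g σ ^ 2 * Real.log (g σ ^ 2 / v)) + 2 * v := by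
  set H := ∑ σ, p σ * (g σ ^ 2 * Real.log (g σ ^ 2 / v)) with hH
  let Φ : ℝ → ℝ := fun s => ∑ σ, p σ * ((m + s * g σ) ^ 2 * Real.log ((m + s * g σ) ^ 2)) -
    (m ^ 2 + s ^ 2 * v) * Real.log (m ^ 2 + s ^ 2 * v) - s ^ 2 * (H + 2 * v)
  let Φ' : ℝ → ℝ := fun s =>
    ∑ σ, p σ * (2 * g σ * (m + s * g σ) * (Real.log ((m + s * g σ) ^ 2) + 1)) -
    2 * s * v * (Real.log (m ^ 2 + s ^ 2 * v) + 1) - 2 * s * (H + 2 * v)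
  let Φ'' : ℝ → ℝ := fun s =>
    ∑ σ, p σ * (2 * g σ ^ 2 * (Real.log ((m + s * g σ) ^ 2) + 3)) -
    (2 * v * (Real.log (m ^ 2 + s ^ 2 * v) + 1) + 4 * s ^ 2 * v ^ 2 / (m ^ 2 + s ^ 2 * v)) -
      2 * (H + 2 * v)
  have hin : ∀ s, 0 ≤ s → s < 1 → ∀ σ, 0 < m + s * g σ := by
    intro s hs0 hs1 σ
    have := mul_nonneg hs0 (hpos σ)
    nlinarith
  have hq : ∀ s, 0 < m ^ 2 + s ^ 2 * v := fun s => by positivity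
  have hqd : ∀ s, HasDerivAt (fun s => m ^ 2 + s ^ 2 * v) (2 * s * v) s := by
    intro s
    have := ((hasDerivAt_pow 2 s).mul_const v).const_add (m ^ 2)
    refine this.congr_deriv ?_
    push_cast
    ring
  have hd1 : ∀ s, 0 ≤ s → s < 1 → HasDerivAt Φ (Φ' s) s := by
    intro s hs0 hs1
    have h1 := HasDerivAt.fun_sum (u := Finset.univ) fun σ _ =>
      (hasDerivAt_sq_mul_log_sq (hin s hs0 hs1 σ).ne').const_mul (p σ)
    have h2 := (hqd s).mul ((hqd s).log (hq s).ne')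
    have h3 := (hasDerivAt_pow 2 s).mul_const (H + 2 * v)
    refine ((h1.sub h2).sub h3).congr_deriv ?_
    have := (hq s).ne'
    simp only [Φ']
    generalize ∑ σ, p σ * (2 * g σ * (m + s * g σ) * (Real.log ((m + s * g σ) ^ 2) + 1)) = S
    field_simp
    push_cast
    ring
  have hd2 : ∀ s, 0 ≤ s → s < 1 → HasDerivAt Φ' (Φ'' s) s := by
    intro s hs0 hs1
    have h1 := HasDerivAt.fun_sum (u := Finset.univ) fun σ _ =>
      (hasDerivAt_mul_log_sq (hin s hs0 hs1 σ).ne').const_mul (p σ)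
    have h2 := (((hasDerivAt_id s).const_mul 2).mul_const v).mul
      (((hqd s).log (hq s).ne').add_const 1)
    have h3 := ((hasDerivAt_id s).const_mul 2).mul_const (H + 2 * v)
    refine ((h1.sub h2).sub h3).congr_deriv ?_
    have := (hq s).ne'
    simp only [Φ'', id]
    generalize ∑ σ, p σ * (2 * g σ ^ 2 * (Real.log ((m + s * g σ) ^ 2) + 3)) = S
    field_simp
    ring
  have hneg : ∀ s, 0 ≤ s → s < 1 → Φ'' s ≤ 0 := by
    intro s hs0 hs1
    have hpt : ∀ σ, p σ * (2 * g σ ^ 2 * (Real.log ((m + s * g σ) ^ 2) + 3)) ≤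
        2 * (p σ * (g σ ^ 2 * Real.log (g σ ^ 2 / v))) +
        (2 * Real.log (m ^ 2 + s ^ 2 * v) + 4) * (p σ * g σ ^ 2) +
        2 * v / (m ^ 2 + s ^ 2 * v) * (p σ * (m + s * g σ) ^ 2) := by
      intro σ
      have hx := hin s hs0 hs1 σ
      have hQ := hq s
      by_cases h0 : g σ = 0
      · have := hp σ
        simp only [h0]
        norm_num
        positivity
      have hg2 : 0 < g σ ^ 2 := by positivity
      have hlog := Real.log_le_sub_one_of_pos
        (show 0 < (m + s * g σ) ^ 2 / ((m ^ 2 + s ^ 2 * v) * (g σ ^ 2 / v)) by positivity)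
      rw [Real.log_div (by positivity) (by positivity), Real.log_mul (by positivity)
        (by positivity)] at hlog
      have h5 := mul_le_mul_of_nonneg_left hlog hg2.le
      have h6 : g σ ^ 2 * ((m + s * g σ) ^ 2 / ((m ^ 2 + s ^ 2 * v) * (g σ ^ 2 / v)) - 1) =
          v / (m ^ 2 + s ^ 2 * v) * (m + s * g σ) ^ 2 - g σ ^ 2 := by
        field_simp
      rw [h6] at h5
      have h7 := mul_le_mul_of_nonneg_left h5 (hp σ)
      have h8 : 2 * v / (m ^ 2 + s ^ 2 * v) = 2 * (v / (m ^ 2 + s ^ 2 * v)) := by ring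
      rw [h8]
      linarith
    have hS := Finset.sum_le_sum fun σ (_ : σ ∈ Finset.univ) => hpt σ
    rw [Finset.sum_add_distrib, Finset.sum_add_distrib, ← Finset.mul_sum, ← Finset.mul_sum,
      ← Finset.mul_sum, ← hH, hvar] at hS
    have hsq : ∑ σ, p σ * (m + s * g σ) ^ 2 = m ^ 2 + s ^ 2 * v := by
      calc ∑ σ, p σ * (m + s * g σ) ^ 2
          = ∑ σ, (m ^ 2 * p σ + 2 * m * s * (p σ * g σ) + s ^ 2 * (p σ * g σ ^ 2)) :=
            Finset.sum_congr rfl fun σ _ => by ring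
        _ = _ := by
            rw [Finset.sum_add_distrib, Finset.sum_add_distrib, ← Finset.mul_sum,
              ← Finset.mul_sum, ← Finset.mul_sum, hsum, hg, hvar]
            ring
    rw [hsq, div_mul_cancel₀ _ (hq s).ne'] at hS
    have h9 : 0 ≤ 4 * s ^ 2 * v ^ 2 / (m ^ 2 + s ^ 2 * v) :=
      div_nonneg (by positivity) (hq s).le
    simp only [Φ'']
    linarith
  have hΦ'0 : Φ' 0 = 0 := by
    simp only [Φ', zero_mul, add_zero, mul_zero, sub_zero]
    calc _ = ∑ σ, (2 * m * (Real.log (m ^ 2) + 1)) * (p σ * g σ) :=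
          Finset.sum_congr rfl fun σ _ => by ring
      _ = 0 := by rw [← Finset.mul_sum, hg, mul_zero]
  have hΦ0 : Φ 0 = 0 := by
    simp only [Φ, zero_mul, add_zero, ← Finset.sum_mul, hsum]
    ring_nf
  have hanti' : AntitoneOn Φ' (Set.Ico 0 1) := by
    refine antitoneOn_of_deriv_nonpos (convex_Ico 0 1)
      (fun s hs => (hd2 s hs.1 hs.2).continuousAt.continuousWithinAt) ?_ ?_
    · intro s hs
      have hs := interior_subset hs
      exact (hd2 s hs.1 hs.2).differentiableAt.differentiableWithinAt
    · intro s hs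
      have hs := interior_subset hs
      rw [(hd2 s hs.1 hs.2).deriv]
      exact hneg s hs.1 hs.2
  have hcont : Continuous Φ := by
    have hc : Continuous fun x : ℝ => x * Real.log x := Real.continuous_mul_log
    refine ((continuous_finsetSum _ fun σ _ => continuous_const.mul
      (hc.comp (show Continuous fun s => (m + s * g σ) ^ 2 by fun_prop))).sub
      (hc.comp (show Continuous fun s => m ^ 2 + s ^ 2 * v by fun_prop))).sub (by fun_prop)
  have hanti : AntitoneOn Φ (Set.Icc 0 1) := by
    refine antitoneOn_of_deriv_nonpos (convex_Icc 0 1) hcont.continuousOn ?_ ?_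
    all_goals
      intro s hs
      rw [interior_Icc] at hs
      have hd := hd1 s hs.1.le hs.2
    · exact hd.differentiableAt.differentiableWithinAt
    · rw [hd.deriv, ← hΦ'0]
      exact hanti' ⟨le_rfl, one_pos⟩ ⟨hs.1.le, hs.2⟩ hs.1.le
  have h1 := hanti (Set.left_mem_Icc.2 zero_le_one) (Set.right_mem_Icc.2 zero_le_one) zero_le_one
  rw [hΦ0] at h1
  simp only [Φ, one_mul, one_pow] at h1
  linarith

theorem pent_le_mul_wvar_sqrt {p f : Ω → ℝ} (hp : ∀ σ, 0 ≤ p σ) (hsum : ∑ σ, p σ = 1)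
    (hf : ∀ σ, 0 ≤ f σ) {q : ℝ} (hq : 0 < q) (hmin : ∀ σ, 0 < p σ → q ≤ p σ) :
    pent p f ≤ (2 + Real.log (1 / q)) *
      (∑ σ, p σ * √(f σ) ^ 2 - (∑ σ, p σ * √(f σ)) ^ 2) := by
  set m := ∑ σ, p σ * √(f σ) with hm
  set v := ∑ σ, p σ * √(f σ) ^ 2 - m ^ 2 with hv
  have hm0 : 0 ≤ m := Finset.sum_nonneg fun σ _ => mul_nonneg (hp σ) (Real.sqrt_nonneg _)
  let g : Ω → ℝ := fun σ => √(f σ) - m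
  have hg : ∑ σ, p σ * g σ = 0 := by
    simp only [g, mul_sub, Finset.sum_sub_distrib, ← Finset.sum_mul, hsum, ← hm]
    ring
  have hvar : ∑ σ, p σ * g σ ^ 2 = v := by
    calc ∑ σ, p σ * g σ ^ 2
        = ∑ σ, (p σ * √(f σ) ^ 2 - 2 * m * (p σ * √(f σ)) + m ^ 2 * p σ) :=
          Finset.sum_congr rfl fun σ _ => by simp only [g]; ring
      _ = v := by
          rw [Finset.sum_add_distrib, Finset.sum_sub_distrib, ← Finset.mul_sum,
            ← Finset.mul_sum, hsum, ← hm, hv]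
          ring
  have hM : pmean p f = m ^ 2 + v := by
    rw [hv, pmean]
    simp only [Real.sq_sqrt (hf _)]
    ring
  have hv0 : 0 ≤ v := by
    rw [← hvar]
    exact Finset.sum_nonneg fun i _ => mul_nonneg (hp i) (sq_nonneg _)
  have hsingle : ∀ σ, p σ * g σ ^ 2 ≤ v := fun σ => by
    rw [← hvar]
    exact Finset.single_le_sum (f := fun σ => p σ * g σ ^ 2)
      (fun i _ => mul_nonneg (hp i) (sq_nonneg _)) (Finset.mem_univ σ)
  have hfg : ∀ σ, f σ = (m + g σ) ^ 2 := fun σ => by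
    simp only [g, add_sub_cancel, Real.sq_sqrt (hf σ)]
  rcases hv0.eq_or_lt with hv0 | hv0
  · have hz : ∀ σ, p σ * (f σ * Real.log (f σ)) = p σ * (m ^ 2 * Real.log (m ^ 2)) := by
      intro σ
      rcases (hp σ).eq_or_lt with h | h
      · simp [← h]
      · have h1 := hsingle σ
        rw [← hv0] at h1
        have h2 : g σ = 0 := by
          by_contra hne
          have : 0 < p σ * g σ ^ 2 := by positivity
          linarith
        rw [hfg, h2, add_zero]
    rw [← hv0, mul_zero, pent, hM, ← hv0, pmean]
    simp only [hz, ← Finset.sum_mul, hsum]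
    simp
  · have hmpos : 0 < m := by
      refine hm0.lt_of_ne' fun h0 => ?_
      have h1 := (Finset.sum_eq_zero_iff_of_nonneg fun σ _ =>
        mul_nonneg (hp σ) (Real.sqrt_nonneg (f σ))).1 (hm.symm.trans h0)
      have h2 : v = 0 := by
        rw [hv, h0, Finset.sum_eq_zero fun σ hσ => by rw [sq, ← mul_assoc, h1 σ hσ, zero_mul]]
        simp
      exact hv0.ne' h2
    have hr := rothaus hp hsum hg hmpos hv0 hvar
      (fun σ => by simp only [g, add_sub_cancel]; exact Real.sqrt_nonneg _)
    have hent : ∑ σ, p σ * (g σ ^ 2 * Real.log (g σ ^ 2 / v)) ≤ v * Real.log (1 / q) := by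
      rw [← hvar, Finset.sum_mul]
      refine Finset.sum_le_sum fun σ _ => ?_
      rw [hvar, ← mul_assoc]
      rcases (hp σ).eq_or_lt with h | h
      · simp [← h]
      by_cases h0 : g σ = 0
      · simp [h0]
      have hg2 : 0 < g σ ^ 2 := by positivity
      refine mul_le_mul_of_nonneg_left (Real.log_le_log (by positivity) ?_) (by positivity)
      rw [div_le_div_iff₀ hv0 hq, one_mul, mul_comm]
      exact (mul_le_mul_of_nonneg_right (hmin σ h) hg2.le).trans (hsingle σ)
    have hE : pent p f = ∑ σ, p σ * ((m + g σ) ^ 2 * Real.log ((m + g σ) ^ 2)) -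
        (m ^ 2 + v) * Real.log (m ^ 2 + v) := by
      rw [pent, hM, pmean]
      simp only [hfg]
    rw [hE]
    linarith

end Entropy

section Pinning

variable {n : ℕ} {𝒳 : Fin n → Type*}

/-- The weight `π` restricted to the configurations agreeing with `τ` on `Λ`. -/
def pin (π : (∀ i, 𝒳 i) → ℝ) (Λ : Finset (Fin n)) (τ σ : ∀ i, 𝒳 i) : ℝ :=
  if ∀ k ∈ Λ, σ k = τ k then π σ else 0

/-- Variance of `f` under the conditional law at coordinate `i` given the other coordinates. -/
def localVar [∀ i, Fintype (𝒳 i)]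
    (π : (∀ i, 𝒳 i) → ℝ) (f : (∀ i, 𝒳 i) → ℝ) (i : Fin n) (σ : ∀ i, 𝒳 i) : ℝ :=
  ∑ t, condD π {i} σ t * f t ^ 2 - (∑ t, condD π {i} σ t * f t) ^ 2

theorem pin_nonneg {π : (∀ i, 𝒳 i) → ℝ} (hnn : ∀ σ, 0 ≤ π σ) (Λ : Finset (Fin n))
    (τ σ : ∀ i, 𝒳 i) : 0 ≤ pin π Λ τ σ := by
  unfold pin
  split_ifs
  exacts [hnn σ, le_rfl]

theorem agree_of_pin_pos {π : (∀ i, 𝒳 i) → ℝ} {Λ : Finset (Fin n)} {τ σ : ∀ i, 𝒳 i}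
    (h : 0 < pin π Λ τ σ) : (∀ k ∈ Λ, σ k = τ k) ∧ 0 < π σ := by
  unfold pin at h
  split_ifs at h with h1
  · exact ⟨h1, h⟩
  · exact absurd h (lt_irrefl 0)

theorem prEvent_pos [∀ i, Fintype (𝒳 i)]
    {π : (∀ i, 𝒳 i) → ℝ} (hnn : ∀ σ, 0 ≤ π σ) {E : (∀ i, 𝒳 i) → Prop}
    {σ : ∀ i, 𝒳 i} (h : 0 < π σ) (hE : E σ) : 0 < prEvent π E :=
  h.trans_le (Finset.single_le_sum (f := π) (fun i _ => hnn i) (by simpa using hE))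

theorem agree_insert_update_iff {Λ : Finset (Fin n)} {i : Fin n} (hi : i ∉ Λ) (τ σ : ∀ i, 𝒳 i)
    (c : 𝒳 i) : (∀ k ∈ insert i Λ, σ k = Function.update τ i c k) ↔
      σ i = c ∧ ∀ k ∈ Λ, σ k = τ k := by
  rw [Finset.forall_mem_insert, Function.update_self]
  refine and_congr_right fun _ => forall₂_congr fun k hk => ?_
  rw [Function.update_of_ne (ne_of_mem_of_not_mem hk hi)]

theorem pin_insert {Λ : Finset (Fin n)} {i : Fin n} (hi : i ∉ Λ) (π : (∀ i, 𝒳 i) → ℝ)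
    (τ : ∀ i, 𝒳 i) (c : 𝒳 i) : pin π (insert i Λ) (Function.update τ i c) =
      fun σ => if σ i = c then pin π Λ τ σ else 0 := by
  ext σ
  simp only [pin, agree_insert_update_iff hi, ite_and]

theorem condLaw_pin [∀ i, Fintype (𝒳 i)]
    {Λ : Finset (Fin n)} {i : Fin n} (hi : i ∉ Λ) (π : (∀ i, 𝒳 i) → ℝ)
    (τ σ : ∀ i, 𝒳 i) (j : Fin n) (y : 𝒳 j) :
    condLaw (pin π Λ τ) (fun σ => σ i) (fun σ => σ j) σ y =
      cmarg π (insert i Λ) (Function.update τ i (σ i)) j y := by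
  simp only [condLaw, cmarg, prEvent, agree_insert_update_iff hi, pin, Finset.sum_filter, ite_and]
  congr 1
  refine Finset.sum_congr rfl fun t _ => ?_
  split_ifs <;> rfl

theorem sum_pin_localVar_eq [∀ i, Fintype (𝒳 i)]
    {π : (∀ i, 𝒳 i) → ℝ} (hnn : ∀ σ, 0 ≤ π σ) {Λ : Finset (Fin n)}
    {i : Fin n} (hΛ : Λᶜ = {i}) (τ : ∀ i, 𝒳 i) (f : (∀ i, 𝒳 i) → ℝ) :
    ∑ σ, pin π Λ τ σ * localVar π f i σ = wvar (pin π Λ τ) f := by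
  set Z := ∑ σ, pin π Λ τ σ with hZ
  have hk : ∀ k, k ∉ ({i} : Finset (Fin n)) ↔ k ∈ Λ := fun k => by
    rw [← hΛ, Finset.mem_compl, not_not]
  rcases (Finset.sum_nonneg fun σ (_ : σ ∈ Finset.univ) => pin_nonneg hnn Λ τ σ).eq_or_lt
    with h | h
  · have h0 := (Finset.sum_eq_zero_iff_of_nonneg fun σ _ => pin_nonneg hnn Λ τ σ).1 h.symm
    have h1 : ∀ σ, pin π Λ τ σ = 0 := fun σ => h0 σ (Finset.mem_univ σ)
    simp [wvar, h1]
  · rw [← hZ] at h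
    have hcond : ∀ σ, 0 < pin π Λ τ σ → ∀ t, condD π {i} σ t = pin π Λ τ t / Z := by
      intro σ hσ t
      have hag := (agree_of_pin_pos hσ).1
      have e : ∀ t : ∀ i, 𝒳 i, (∀ k, k ∉ ({i} : Finset (Fin n)) → t k = σ k) ↔
          ∀ k ∈ Λ, t k = τ k := fun t =>
        forall_congr' fun k => by
          rw [hk]
          exact forall_congr' fun hkΛ => by rw [hag k hkΛ]
      have eZ : prEvent π (fun t => ∀ k, k ∉ ({i} : Finset (Fin n)) → t k = σ k) = Z := by
        simp only [prEvent, e, hZ, pin, Finset.sum_filter]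
      rw [condD, eZ, pin]
      simp only [e]
      split_ifs
      · rfl
      · simp
    have hloc : ∀ σ, pin π Λ τ σ * localVar π f i σ =
        pin π Λ τ σ * (wvar (pin π Λ τ) f / Z) := by
      intro σ
      rcases (pin_nonneg hnn Λ τ σ).eq_or_lt with h0 | h0
      · rw [← h0, zero_mul, zero_mul]
      · congr 1
        simp only [localVar, hcond σ h0, wvar, ← hZ, div_mul_eq_mul_div, ← Finset.sum_div]
        field_simp
    rw [Finset.sum_congr rfl fun σ _ => hloc σ, ← Finset.sum_mul, ← hZ]
    field_simp

/-- Approximate tensorization of variance, for every pinning. -/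
theorem pow_mul_wvar_pin_le [∀ i, Fintype (𝒳 i)]
    {π : (∀ i, 𝒳 i) → ℝ} (hnn : ∀ σ, 0 ≤ π σ) {ε : ℝ} (hε0 : 0 < ε)
    (hε1 : ε ≤ 1)
    (hinf : ∀ Λ : Finset (Fin n), Λ.card ≤ n - 2 →
      ∀ τ : ∀ i, 𝒳 i, 0 < prEvent π (fun σ => ∀ k ∈ Λ, σ k = τ k) →
      ∀ i j : Fin n, i ∉ Λ → j ∉ Λ → i ≠ j →
      ∀ xi xi' : 𝒳 i,
        0 < prEvent π (fun σ => (∀ k ∈ Λ, σ k = τ k) ∧ σ i = xi) →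
        0 < prEvent π (fun σ => (∀ k ∈ Λ, σ k = τ k) ∧ σ i = xi') →
        ptv (cmarg π (insert i Λ) (Function.update τ i xi) j)
            (cmarg π (insert i Λ) (Function.update τ i xi') j) ≤ 1 - ε)
    (f : (∀ i, 𝒳 i) → ℝ) (m : ℕ) (Λ : Finset (Fin n)) (hΛ : Λᶜ.card = m + 1) (τ : ∀ i, 𝒳 i) :
    ε ^ m * wvar (pin π Λ τ) f ≤ ∑ i ∈ Λᶜ, ∑ σ, pin π Λ τ σ * localVar π f i σ := by
  induction m generalizing Λ τ with
  | zero =>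
    obtain ⟨i, hi⟩ := Finset.card_eq_one.1 (by simpa using hΛ)
    rw [hi, Finset.sum_singleton, sum_pin_localVar_eq hnn hi, pow_zero, one_mul]
  | succ m ih =>
    set μ := pin π Λ τ with hμdef
    have hμ : ∀ σ, 0 ≤ μ σ := pin_nonneg hnn Λ τ
    set a := (∑ σ, μ σ * f σ) / ∑ σ, μ σ with ha
    set g : (∀ i, 𝒳 i) → ℝ := fun σ => f σ - a with hgdef
    have hg : ∑ σ, μ σ * g σ = 0 := by
      simp only [hgdef, mul_sub, Finset.sum_sub_distrib, ← Finset.sum_mul]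
      by_cases hZ : ∑ σ, μ σ = 0
      · have h0 := (Finset.sum_eq_zero_iff_of_nonneg fun σ _ => hμ σ).1 hZ
        have h1 : ∀ σ, μ σ = 0 := fun σ => h0 σ (Finset.mem_univ σ)
        simp [h1]
      · rw [ha]
        field_simp
        ring
    have hW : wvar μ f = ∑ σ, μ σ * g σ ^ 2 := by
      rw [← wvar_sub_const hμ f a]
      change wvar μ g = _
      rw [wvar, hg]
      simp
    let D : Fin n → ℝ := fun j => ∑ σ, μ σ * localVar π f j σ
    have hcard : Λ.card + (m + 2) = n := by
      have := Finset.card_add_card_compl Λ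
      rw [Fintype.card_fin] at this
      omega
    have hTV : ∀ i ∈ Λᶜ, ∀ j ∈ Λᶜ, i ≠ j → ∀ σ σ', 0 < μ σ → 0 < μ σ' →
        ∑ y, |condLaw μ (fun σ => σ i) (fun σ => σ j) σ y -
          condLaw μ (fun σ => σ i) (fun σ => σ j) σ' y| ≤ 2 * (1 - ε) := by
      intro i hi j hj hij σ σ' hσ hσ'
      rw [Finset.mem_compl] at hi hj
      obtain ⟨h1, h2⟩ := agree_of_pin_pos hσ
      obtain ⟨h1', h2'⟩ := agree_of_pin_pos hσ'
      have := hinf Λ (by omega) τ (prEvent_pos hnn h2 h1) i j hi hj hij (σ i) (σ' i)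
        (prEvent_pos hnn h2 ⟨h1, rfl⟩) (prEvent_pos hnn h2' ⟨h1', rfl⟩)
      simp only [hμdef, condLaw_pin hi]
      rw [ptv] at this
      linarith
    have hkey := sum_sum_condMean_sq_le hμ (fun i σ => σ i) Λᶜ (by linarith) (by linarith) hTV hg
    have hstep : ∀ i ∈ Λᶜ, ε ^ m * (∑ σ, μ σ * g σ ^ 2 -
        ∑ σ, μ σ * condMean μ (fun σ => σ i) g σ ^ 2) ≤ ∑ j ∈ Λᶜ, D j - D i := by
      intro i hi
      have hi' : i ∉ Λ := Finset.mem_compl.1 hi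
      have hcompl : (insert i Λ)ᶜ = Λᶜ.erase i := Finset.compl_insert
      have hc : ∀ c : 𝒳 i, ε ^ m * wvar (fun σ => if σ i = c then μ σ else 0) g ≤
          ∑ j ∈ Λᶜ.erase i, ∑ σ, (if σ i = c then μ σ else 0) * localVar π f j σ := by
        intro c
        have h1 := ih (insert i Λ) (by rw [hcompl, Finset.card_erase_of_mem hi, hΛ]; rfl)
          (Function.update τ i c)
        rw [hcompl, pin_insert hi'] at h1
        rwa [hgdef, wvar_sub_const (fun σ => by split_ifs; exacts [hμ σ, le_rfl])]
      have hs := Finset.sum_le_sum fun c (_ : c ∈ Finset.univ) => hc c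
      rw [← Finset.mul_sum, sum_wvar_fiber (fun σ : ∀ i, 𝒳 i => σ i) g, Finset.sum_comm] at hs
      rw [← Finset.sum_erase_eq_sub hi]
      refine hs.trans (le_of_eq (Finset.sum_congr rfl fun j _ => ?_))
      rw [Finset.sum_comm]
      refine Finset.sum_congr rfl fun σ _ => ?_
      rw [← Finset.sum_mul, Finset.sum_ite_eq, if_pos (Finset.mem_univ _)]
    have hs := Finset.sum_le_sum hstep
    rw [← Finset.mul_sum, Finset.sum_sub_distrib, Finset.sum_sub_distrib, Finset.sum_const,
      Finset.sum_const, hΛ, nsmul_eq_mul, nsmul_eq_mul] at hs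
    rw [hΛ] at hkey
    rw [hW]
    set Q := ∑ σ, μ σ * g σ ^ 2
    have hεm : 0 < ε ^ m := pow_pos hε0 m
    have hk2 := mul_le_mul_of_nonneg_left hkey hεm.le
    push_cast at hs hk2
    change _ ≤ ∑ i ∈ Λᶜ, D i
    refine le_of_mul_le_mul_left ?_ (show (0 : ℝ) < m + 1 by positivity)
    rw [pow_succ]
    linarith

end Pinning

/-- **Crude approximate tensorization of entropy via pairwise influence bounds.**
If for every partial assignment on at most `n−2` coordinates, conditioning any further
coordinate `i` on two values changes the conditional marginal of any other coordinate
`j` by at most `1−ε` in total variation, then for nonnegative `f`,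
`Ent f ≤ ((2 + log(1/π_min))/ε^{n−1}) Σ_i E[Ent_i f]`. -/
theorem ent_tensorization_crude_bound
    {n : ℕ} {𝒳 : Fin n → Type*} [∀ i, Fintype (𝒳 i)] [∀ i, Nonempty (𝒳 i)]
    (π : (∀ i, 𝒳 i) → ℝ) (hnn : ∀ σ, 0 ≤ π σ) (hsum : ∑ σ, π σ = 1)
    (hmarg : ∀ (i : Fin n) (c : 𝒳 i), 0 < prEvent π (fun σ => σ i = c))
    (ε : ℝ) (hε0 : 0 < ε) (hε1 : ε ≤ 1)
    (hinf : ∀ Λ : Finset (Fin n), Λ.card ≤ n - 2 →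
      ∀ τ : ∀ i, 𝒳 i, 0 < prEvent π (fun σ => ∀ k ∈ Λ, σ k = τ k) →
      ∀ i j : Fin n, i ∉ Λ → j ∉ Λ → i ≠ j →
      ∀ xi xi' : 𝒳 i,
        0 < prEvent π (fun σ => (∀ k ∈ Λ, σ k = τ k) ∧ σ i = xi) →
        0 < prEvent π (fun σ => (∀ k ∈ Λ, σ k = τ k) ∧ σ i = xi') →
        ptv (cmarg π (insert i Λ) (Function.update τ i xi) j)
            (cmarg π (insert i Λ) (Function.update τ i xi') j) ≤ 1 - ε)
    (πmin : ℝ) (hπmin : IsLeast {p : ℝ | (∃ σ, π σ = p) ∧ 0 < p} πmin)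
    (f : (∀ i, 𝒳 i) → ℝ) (hf : ∀ σ, 0 ≤ f σ) :
    pent π f ≤ ((2 + Real.log (1 / πmin)) / ε ^ (n - 1)) *
      ∑ i : Fin n, pmean π (fun σ => pent (condD π {i} σ) f) := by
  obtain ⟨⟨⟨σ₀, hσ₀⟩, hπ0⟩, hmin⟩ := hπmin
  have hC : 0 ≤ 2 + Real.log (1 / πmin) := by
    have h1 : πmin ≤ 1 := by
      rw [← hσ₀, ← hsum]
      exact Finset.single_le_sum (fun i _ => hnn i) (Finset.mem_univ σ₀)
    have := Real.log_nonneg (one_le_one_div hπ0 h1)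
    linarith
  have hent := pent_le_mul_wvar_sqrt hnn hsum hf hπ0 fun σ hσ => hmin ⟨⟨σ, rfl⟩, hσ⟩
  have hcond : ∀ (i : Fin n) (σ : ∀ i, 𝒳 i) t, 0 ≤ condD π {i} σ t := by
    intro i σ t
    unfold condD
    split_ifs
    exacts [div_nonneg (hnn t) (Finset.sum_nonneg fun s _ => hnn s), le_rfl]
  have hloc : ∀ i : Fin n, ∑ σ, π σ * localVar π (fun σ => √(f σ)) i σ ≤
      pmean π (fun σ => pent (condD π {i} σ) f) := fun i =>
    Finset.sum_le_sum fun σ _ =>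
      mul_le_mul_of_nonneg_left (sum_sub_sq_sum_sqrt_le_pent (hcond i σ) hf) (hnn σ)
  have hpin : pin π ∅ σ₀ = π := by
    ext σ
    simp [pin]
  have hvar : ε ^ (n - 1) * (∑ σ, π σ * √(f σ) ^ 2 - (∑ σ, π σ * √(f σ)) ^ 2) ≤
      ∑ i : Fin n, pmean π (fun σ => pent (condD π {i} σ) f) := by
    rcases Nat.eq_zero_or_pos n with rfl | hn
    · have huniq : ∀ σ, σ = σ₀ := fun σ => Subsingleton.elim _ _
      have hu : (Finset.univ : Finset (∀ i, 𝒳 i)) = {σ₀} :=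
        Finset.eq_singleton_iff_unique_mem.2 ⟨Finset.mem_univ _, fun σ _ => huniq σ⟩
      have h1 : π σ₀ = 1 := by rw [← hsum, hu, Finset.sum_singleton]
      rw [hu]
      simp [h1]
    · have h1 := pow_mul_wvar_pin_le hnn hε0 hε1 hinf (fun σ => √(f σ)) (n - 1) ∅
        (by rw [Finset.compl_empty, Finset.card_univ, Fintype.card_fin]; omega) σ₀
      rw [hpin, wvar, hsum, div_one, Finset.compl_empty] at h1
      exact h1.trans (Finset.sum_le_sum fun i _ => hloc i)
  rw [div_mul_eq_mul_div, mul_div_assoc]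
  refine hent.trans (mul_le_mul_of_nonneg_left ?_ hC)
  rw [le_div_iff₀ (pow_pos hε0 _), mul_comm]
  exact hvar

end
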